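/- arXiv:2006.12942 — 2 statements merged into one kernel-verified Lean document; each statement's English description precedes it below -/
import Mathlib

section
/- Let 0 → E_{−1} → E_0 → ⋯ → E_l → 0 be a cochain complex of finitely generated k[X]-modules. Assume: (1) E_{−1} is projective and, for i = 0, …, l−1, the module E_i has projective dimension at most i; (2) S contains the support of the cohomology of this complex; (3) for i = 0, …, l, the module E_i is a submodule of a free k[X]-module; (4) X is normal and p ≥ l + 2, where p is the codimension of S in X. Then the complex is exact and E_l has projective dimension at most l. -/
/-- A commutative ring is Cohen–Macaulay if it is Noetherian and, for every maximal
ideal, the localization admits a regular sequence (contained in the maximal ideal)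
whose length equals the Krull dimension of the localization
(i.e. depth = dimension for all localizations at maximal ideals). -/
def IsCohenMacaulayRing (A : Type*) [CommRing A] : Prop :=
  IsNoetherianRing A ∧
  ∀ P : Ideal A, ∀ hP : P.IsMaximal,
    haveI : P.IsPrime := hP.isPrime
    ∃ rs : List (Localization.AtPrime P),
      (∀ r ∈ rs, r ∈ IsLocalRing.maximalIdeal (Localization.AtPrime P)) ∧
      RingTheory.Sequence.IsRegular (Localization.AtPrime P) rs ∧
      ((rs.length : ℕ∞) : WithBot ℕ∞) = ringKrullDim (Localization.AtPrime P)


universe u v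

/-- `ProjDimLE A n M` says that the `A`-module `M` has projective dimension at most `n`,
i.e. it admits a projective resolution of length at most `n`. -/
def ProjDimLE (A : Type u) [Ring A] :
    ℕ → (M : Type v) → [AddCommGroup M] → [Module A M] → Prop
  | 0, M, _, _ => Module.Projective A M
  | n + 1, M, _, _ =>
    ∃ (P : Type v) (_ : AddCommGroup P) (_ : Module A P) (f : P →ₗ[A] M),
      Module.Projective A P ∧ Function.Surjective f ∧
        ProjDimLE A n ↥(LinearMap.ker f)

open CategoryTheory Abelian RingTheory.Sequence

section Ischebeck

variable {R : Type u} [CommRing R]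

lemma ModuleCat.subsingleton_ext_of_subsingleton (N M : ModuleCat.{u} R) [Subsingleton N] (i : ℕ) :
    Subsingleton (Ext N M i) := by
  have : HasProjectiveDimensionLT N 0 :=
    Limits.IsZero.hasProjectiveDimensionLT_zero (ModuleCat.isZero_of_subsingleton N)
  exact HasProjectiveDimensionLT.subsingleton N 0 i (Nat.zero_le i) M

lemma CategoryTheory.ShortComplex.ShortExact.subsingleton_ext_X₂ {S : ShortComplex (ModuleCat.{u} R)}
    (hS : S.ShortExact) (M : ModuleCat.{u} R) {i : ℕ}
    (h₁ : Subsingleton (Ext S.X₁ M i)) (h₃ : Subsingleton (Ext S.X₃ M i)) :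
    Subsingleton (Ext S.X₂ M i) := by
  refine subsingleton_of_forall_eq 0 fun x ↦ ?_
  obtain ⟨y, rfl⟩ := Ext.contravariant_sequence_exact₂ hS M x (Subsingleton.elim _ _)
  rw [Subsingleton.elim y 0, Ext.comp_zero]

variable [IsNoetherianRing R] [IsLocalRing R]

/-- If `x` is a nonzerodivisor on `N` in the maximal ideal of a Noetherian local ring, then
vanishing of `Ext (N ⧸ xN) M (i + 1)` implies vanishing of `Ext N M i`. -/
lemma ModuleCat.subsingleton_ext_of_quotSMulTop (N M : ModuleCat.{u} R) [Module.Finite R N]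
    [Module.Finite R M] {x : R} (hx : x ∈ IsLocalRing.maximalIdeal R) (reg : IsSMulRegular N x)
    {i : ℕ} (h : Subsingleton (Ext (ModuleCat.of R (QuotSMulTop x N)) M (i + 1))) :
    Subsingleton (Ext N M i) := by
  rw [← Submodule.subsingleton_iff R, ← subsingleton_iff_bot_eq_top, eq_comm]
  refine Submodule.eq_bot_of_le_smul_of_le_jacobson_bot (Ideal.span {x}) ⊤
    Module.Finite.fg_top (fun e _ ↦ ?_) ?_
  · obtain ⟨(e' : Ext N M i), he'⟩ :=
      Ext.contravariant_sequence_exact₁ reg.smulShortComplex_shortExact M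
        (n₁ := i + 1) e (add_comm 1 i) (h.elim _ _)
    have hmul : (Ext.mk₀ (x • 𝟙 N)).comp e' (zero_add i) = x • e' := by simp [Ext.mk₀_smul]
    have : x • e' = e := hmul.symm.trans he'
    rw [← this]
    exact Submodule.smul_mem_smul (Ideal.mem_span_singleton_self x) Submodule.mem_top
  · rw [IsLocalRing.jacobson_eq_maximalIdeal ⊥ bot_ne_top, Ideal.span_singleton_le_iff_mem]
    exact hx

/-- Ischebeck's vanishing theorem for a maximal Cohen–Macaulay module `M` over a Noetherian local
ring. -/
theorem ModuleCat.subsingleton_ext_of_le_height (M : ModuleCat.{u} R) [Module.Finite R M]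
    {rs : List R} (mem : ∀ r ∈ rs, r ∈ IsLocalRing.maximalIdeal R) (reg : IsRegular M rs)
    (dim : ringKrullDim R = ((rs.length : ℕ∞) : WithBot ℕ∞)) {g : ℕ} (N : ModuleCat.{u} R)
    [Module.Finite R N] (hN : ∀ q ∈ Module.support R N, (g : ℕ∞) ≤ q.asIdeal.height)
    {i : ℕ} (hi : i < g) : Subsingleton (Ext N M i) := by
  have height_le (q : PrimeSpectrum R) : q.asIdeal.height ≤ rs.length := by
    have := Ideal.height_le_ringKrullDim_of_isPrime (I := q.asIdeal)
    rw [dim] at this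
    exact_mod_cast this
  have max_height : (IsLocalRing.maximalIdeal R).height = rs.length := by
    have := IsLocalRing.maximalIdeal_height_eq_ringKrullDim (R := R)
    rw [dim] at this
    exact_mod_cast this
  obtain ⟨r, hr⟩ : ∃ r, rs.length ≤ g + r := ⟨rs.length, Nat.le_add_left _ _⟩
  induction r generalizing g i N with
  | zero =>
    by_cases hsub : Subsingleton N
    · exact ModuleCat.subsingleton_ext_of_subsingleton N M i
    rw [not_subsingleton_iff_nontrivial] at hsub
    obtain ⟨q, hq⟩ := Module.nonempty_support_of_nontrivial (R := R) (M := N)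
    have hg : g ≤ rs.length := by exact_mod_cast (hN q hq).trans (height_le q)
    have hgl : g = rs.length := by omega
    have : Nontrivial M := by
      by_contra! hM
      exact reg.2 (Subsingleton.elim _ _)
    refine ModuleCat.subsingleton_ext_of_exists_isRegular (IsLocalRing.maximalIdeal R) N ?_ M ?_
      rs mem reg i (hgl ▸ hi)
    · intro q hq
      by_contra hne
      have hlt : q.asIdeal < IsLocalRing.maximalIdeal R :=
        lt_of_le_not_ge (IsLocalRing.le_maximalIdeal q.2.ne_top) hne
      have := Ideal.height_add_one_le_of_lt_of_isPrime hlt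
      rw [max_height, ← hgl] at this
      have := (add_le_add_left (hN q hq) 1).trans this
      norm_cast at this
      omega
    · rw [lt_top_iff_ne_top, ne_comm]
      exact Submodule.top_ne_ideal_smul_of_le_jacobson_annihilator
        (IsLocalRing.maximalIdeal_le_jacobson _)
  | succ r ih =>
    suffices H : ∀ (P : Type u) [AddCommGroup P] [Module R P] [Module.Finite R P],
        (∀ q ∈ Module.support R P, (g : ℕ∞) ≤ q.asIdeal.height) →
          Subsingleton (Ext (ModuleCat.of R P) M i) from H N hN
    intro P _ _ hP
    refine IsNoetherianRing.induction_on_isQuotientEquivQuotientPrime R hP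
      (motive := fun P _ _ _ ↦ (∀ q ∈ Module.support R P, (g : ℕ∞) ≤ q.asIdeal.height) →
          Subsingleton (Ext (ModuleCat.of R P) M i)) ?_ ?_ ?_
    · intro P _ _ _ _ _
      exact ModuleCat.subsingleton_ext_of_subsingleton _ M i
    · intro P _ _ _ p e hP
      have hsupp : Module.support R P = PrimeSpectrum.zeroLocus p.asIdeal := by
        rw [e.support_eq, Module.support_eq_zeroLocus, Ideal.annihilator_quotient]
      have hp : (g : ℕ∞) ≤ p.asIdeal.height := hP p (by rw [hsupp]; exact le_refl p.asIdeal)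
      by_cases hmax : p.asIdeal = IsLocalRing.maximalIdeal R
      · have : (rs.length : ℕ∞) ≤ p.asIdeal.height := by rw [hmax, max_height]
        refine ih (g := max g rs.length) (i := i) (ModuleCat.of R P) (fun q hq ↦ ?_)
          (lt_max_of_lt_left hi) ((le_max_right _ _).trans (Nat.le_add_right _ _))
        have hpq : p.asIdeal ≤ q.asIdeal := by rwa [hsupp] at hq
        exact (max_le hp this).trans (Ideal.height_mono hpq)
      · obtain ⟨x, hxm, hxp⟩ := Set.exists_of_ssubset
          (SetLike.coe_ssubset_coe.2
            (lt_of_le_of_ne (IsLocalRing.le_maximalIdeal p.2.ne_top) hmax))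
        have hreg : IsSMulRegular P x := by
          rw [isSMulRegular_iff_right_eq_zero_of_smul]
          intro y hy
          obtain ⟨a, ha⟩ := Ideal.Quotient.mk_surjective (e y)
          have h0 : e (x • y) = 0 := by rw [hy, map_zero]
          rw [map_smul, ← ha, ← Ideal.Quotient.mk_eq_mk, ← Submodule.Quotient.mk_smul,
            Submodule.Quotient.mk_eq_zero] at h0
          have hap := (p.2.mem_or_mem h0).resolve_left hxp
          rw [← e.map_eq_zero_iff, ← ha]
          exact Ideal.Quotient.eq_zero_iff_mem.2 hap
        refine ModuleCat.subsingleton_ext_of_quotSMulTop (ModuleCat.of R P) M hxm hreg ?_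
        refine ih (g := g + 1) (i := i + 1) _ (fun q hq ↦ ?_) (by omega) (by omega)
        have hq' : q ∈ Module.support R P ∩ PrimeSpectrum.zeroLocus {x} := by
          rw [← Module.support_quotSMulTop]; exact hq
        rw [hsupp] at hq'
        have hlt : p.asIdeal < q.asIdeal :=
          lt_of_le_not_ge hq'.1 fun h ↦ hxp (h (hq'.2 rfl))
        push_cast
        exact (add_le_add_left hp 1).trans (Ideal.height_add_one_le_of_lt_of_isPrime hlt)
    · intro P₁ _ _ _ P₂ _ _ _ P₃ _ _ _ f₁ f₂ hf₁ hf₂ hex h₁ h₃ hP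
      let S := ModuleCat.shortComplexOfCompEqZero f₁ f₂ hex.linearMap_comp_eq_zero
      have hS : S.ShortExact := ModuleCat.shortComplex_shortExact S hex hf₁ hf₂
      exact hS.subsingleton_ext_X₂ M
        (h₁ fun q hq ↦ hP q (Module.support_subset_of_injective f₁ hf₁ hq))
        (h₃ fun q hq ↦ hP q (Module.support_subset_of_surjective f₂ hf₂ hq))

end Ischebeck

section ProjectiveDimension

variable {R : Type u} [CommRing R]

lemma ModuleCat.subsingleton_ext_of_projective (N P : ModuleCat.{u} R) [Module.Finite R P]
    [Module.Projective R P] {i : ℕ} (h : Subsingleton (Ext N (ModuleCat.of R R) i)) :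
    Subsingleton (Ext N P i) := by
  obtain ⟨n, f, g, -, -, hfg⟩ := Module.Finite.exists_comp_eq_id_of_projective R P
  refine subsingleton_of_forall_eq 0 fun x ↦ ?_
  have hid : 𝟙 P = ∑ k : Fin n, ModuleCat.ofHom (LinearMap.proj k ∘ₗ g) ≫
      ModuleCat.ofHom (f ∘ₗ LinearMap.single R (fun _ ↦ R) k) := by
    ext y
    have hy := LinearMap.congr_fun hfg y
    simp only [LinearMap.comp_apply, LinearMap.id_apply] at hy
    conv_lhs => rw [ModuleCat.id_apply, ← hy, ← Finset.univ_sum_single (g y), map_sum]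
    simp [ModuleCat.hom_sum]
  have hmk : Ext.mk₀ (𝟙 P) = ∑ k : Fin n, Ext.mk₀ (ModuleCat.ofHom (LinearMap.proj k ∘ₗ g) ≫
      ModuleCat.ofHom (f ∘ₗ LinearMap.single R (fun _ ↦ R) k)) := by
    rw [hid]
    exact map_sum (Ext.addEquiv₀ (X := P) (Y := P)).symm _ _
  rw [← x.comp_mk₀_id, hmk, Ext.comp_sum]
  refine Finset.sum_eq_zero fun k _ ↦ ?_
  rw [← Ext.mk₀_comp_mk₀, ← Ext.comp_assoc_of_second_deg_zero,
    Subsingleton.elim (x.comp (Ext.mk₀ (ModuleCat.ofHom (LinearMap.proj k ∘ₗ g))) _) 0,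
    Ext.zero_comp]

lemma ModuleCat.subsingleton_ext_of_hasProjectiveDimensionLE [IsNoetherianRing R]
    (N : ModuleCat.{u} R) {n : ℕ} (h : ∀ i < n, Subsingleton (Ext N (ModuleCat.of R R) i))
    {j : ℕ} (C : ModuleCat.{u} R) [Module.Finite R C] [HasProjectiveDimensionLE C j]
    {i : ℕ} (hij : i + j < n) : Subsingleton (Ext N C i) := by
  induction j generalizing C i with
  | zero =>
    have : Projective C := (projective_iff_hasProjectiveDimensionLE_zero _).2 ‹_›
    have : Module.Projective R C := (IsProjective.iff_projective (R := R) C).2 this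
    exact N.subsingleton_ext_of_projective C (h i (by omega))
  | succ j ih =>
    obtain ⟨P, _, _, _, _, f, hf⟩ := Module.exists_finite_presentation R C
    have hS := LinearMap.shortExact_shortComplexKer hf
    have hP : Projective f.shortComplexKer.X₂ :=
      ModuleCat.projective_of_categoryTheory_projective _
    have : HasProjectiveDimensionLE (ModuleCat.of R (LinearMap.ker f)) j :=
      (hS.hasProjectiveDimensionLT_X₃_iff j hP).1 ‹_›
    have h₁ := ih (i := i + 1) (ModuleCat.of R (LinearMap.ker f)) (by omega)
    have h₂ : Subsingleton (Ext N (ModuleCat.of R P) i) :=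
      N.subsingleton_ext_of_projective (ModuleCat.of R P) (h i (by omega))
    refine subsingleton_of_forall_eq 0 fun x ↦ ?_
    obtain ⟨y, rfl⟩ := Ext.covariant_sequence_exact₃ N hS x rfl (h₁.elim _ _)
    rw [h₂.elim y 0, Ext.zero_comp]

lemma hasProjectiveDimensionLE_range_of_injective {M N : Type u} [AddCommGroup M] [Module R M]
    [AddCommGroup N] [Module R N] {f : M →ₗ[R] N} (hf : Function.Injective f) (n : ℕ)
    [HasProjectiveDimensionLE (ModuleCat.of R M) n] :
    HasProjectiveDimensionLE (ModuleCat.of R (LinearMap.range f)) n :=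
  hasProjectiveDimensionLT_of_iso (LinearEquiv.ofInjective f hf).toModuleIso _

lemma hasProjectiveDimensionLE_range_of_exact {M N L : Type u} [AddCommGroup M] [Module R M]
    [AddCommGroup N] [Module R N] [AddCommGroup L] [Module R L] {f : M →ₗ[R] N} {g : N →ₗ[R] L}
    (hfg : Function.Exact f g) (n : ℕ)
    [HasProjectiveDimensionLE (ModuleCat.of R (LinearMap.range f)) n]
    [HasProjectiveDimensionLE (ModuleCat.of R N) n] :
    HasProjectiveDimensionLE (ModuleCat.of R (LinearMap.range g)) (n + 1) := by
  have hker : LinearMap.range f = LinearMap.ker g.rangeRestrict := by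
    rw [LinearMap.ker_rangeRestrict, hfg.linearMap_ker_eq]
  have : HasProjectiveDimensionLT (ModuleCat.of R (LinearMap.ker g.rangeRestrict)) (n + 1) :=
    hasProjectiveDimensionLT_of_iso (LinearEquiv.ofEq _ _ hker).toModuleIso _
  exact (LinearMap.shortExact_shortComplexKer g.surjective_rangeRestrict).hasProjectiveDimensionLT_X₃
    (n + 1) this (hasProjectiveDimensionLT_of_ge _ (n + 1) _ (Nat.le_succ _))

theorem projDimLE_iff_hasProjectiveDimensionLE (n : ℕ) (M : Type u) [AddCommGroup M]
    [Module R M] : ProjDimLE R n M ↔ HasProjectiveDimensionLE (ModuleCat.of R M) n := by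
  induction n generalizing M with
  | zero =>
    rw [← projective_iff_hasProjectiveDimensionLE_zero]
    exact IsProjective.iff_projective (R := R) M
  | succ n ih =>
    constructor
    · rintro ⟨P, _, _, f, hP, hf, hker⟩
      exact ((LinearMap.shortExact_shortComplexKer hf).hasProjectiveDimensionLT_X₃_iff n
        ((IsProjective.iff_projective (R := R) P).1 hP)).2 ((ih _).1 hker)
    · intro h
      have hf := Finsupp.linearCombination_id_surjective R M
      exact ⟨M →₀ R, _, _, Finsupp.linearCombination R id, inferInstance, hf,
        (ih _).2 (((LinearMap.shortExact_shortComplexKer hf).hasProjectiveDimensionLT_X₃_iff n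
          ((IsProjective.iff_projective (R := R) (M →₀ R)).1 inferInstance)).1 h)⟩

lemma hasProjectiveDimensionLE_localizedModule (S : Submonoid R) (n : ℕ) (M : Type u)
    [AddCommGroup M] [Module R M] [HasProjectiveDimensionLE (ModuleCat.of R M) n] :
    HasProjectiveDimensionLE (ModuleCat.of (Localization S) (LocalizedModule S M)) n := by
  have := ModuleCat.localizedModule_hasProjectiveDimensionLE n S (ModuleCat.of R M)
  exact hasProjectiveDimensionLT_of_iso (X := (ModuleCat.of R M).localizedModule S)
    (Shrink.linearEquiv (Localization S) (LocalizedModule S M)).toModuleIso _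

lemma CategoryTheory.ShortComplex.ShortExact.exists_section {S : ShortComplex (ModuleCat.{u} R)}
    (hS : S.ShortExact) (h : Subsingleton (Ext S.X₃ S.X₁ 1)) :
    ∃ s : S.X₃ ⟶ S.X₂, s ≫ S.g = 𝟙 _ := by
  obtain ⟨x, hx⟩ := Ext.covariant_sequence_exact₃ S.X₃ hS (Ext.mk₀ (𝟙 S.X₃)) (zero_add 1)
    (h.elim _ _)
  obtain ⟨s, rfl⟩ := Ext.homEquiv₀.symm.surjective x
  exact ⟨s, Ext.homEquiv₀.symm.injective (by simpa using hx)⟩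

/-- If `B ≤ K` are submodules of a torsion-free module such that `K ⧸ B` is torsion and
`Ext (K ⧸ B) B 1` vanishes, then `B = K`. -/
lemma Submodule.eq_of_subsingleton_ext [IsDomain R] {F : Type u} [AddCommGroup F] [Module R F]
    [Module.IsTorsionFree R F] {B K : Submodule R F} (hBK : B ≤ K)
    (htors : ∀ x ∈ K, ∃ r : R, r ≠ 0 ∧ r • x ∈ B)
    (h : Subsingleton (Ext (ModuleCat.of R (K ⧸ B.submoduleOf K)) (ModuleCat.of R B) 1)) :
    B = K := by
  have hex : Function.Exact (Submodule.inclusion hBK) (B.submoduleOf K).mkQ := by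
    rw [LinearMap.exact_iff, Submodule.ker_mkQ, Submodule.range_inclusion]
    rfl
  let S := ModuleCat.shortComplexOfCompEqZero (Submodule.inclusion hBK) (B.submoduleOf K).mkQ
    hex.linearMap_comp_eq_zero
  have hS : S.ShortExact := ModuleCat.shortComplex_shortExact S hex
    (Submodule.inclusion_injective hBK) (Submodule.mkQ_surjective _)
  obtain ⟨s, hs⟩ := hS.exists_section h
  let t : (K ⧸ B.submoduleOf K) →ₗ[R] K := s.hom
  have ht (y) : (B.submoduleOf K).mkQ (t y) = y := LinearMap.congr_fun (congrArg (·.hom) hs) y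
  refine le_antisymm hBK fun x hx ↦ ?_
  obtain ⟨r, hr, hrx⟩ := htors x hx
  have h0 : (B.submoduleOf K).mkQ (r • ⟨x, hx⟩) = 0 := by
    rw [Submodule.mkQ_apply, Submodule.Quotient.mk_eq_zero]
    exact hrx
  have h1 : r • t ((B.submoduleOf K).mkQ ⟨x, hx⟩) = 0 := by
    rw [← map_smul, ← map_smul, h0, map_zero]
  have h2 : t ((B.submoduleOf K).mkQ ⟨x, hx⟩) = 0 := (smul_eq_zero.1 h1).resolve_left hr
  have h3 := ht ((B.submoduleOf K).mkQ ⟨x, hx⟩)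
  rw [h2, map_zero, eq_comm, Submodule.mkQ_apply, Submodule.Quotient.mk_eq_zero] at h3
  exact h3

end ProjectiveDimension

section Complex

lemma PrimeSpectrum.exists_smul_mem_of_support_subset {R M : Type*} [CommRing R] [AddCommGroup M]
    [Module R M] {B K : Submodule R M} {q : PrimeSpectrum R}
    (hq : q ∉ Module.support R (K ⧸ B.submoduleOf K)) {x : M} (hx : x ∈ K) :
    ∃ r ∉ q.asIdeal, r • x ∈ B := by
  obtain ⟨r, hr, h⟩ := Module.notMem_support_iff'.1 hq ((B.submoduleOf K).mkQ ⟨x, hx⟩)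
  rw [← map_smul, Submodule.mkQ_apply, Submodule.Quotient.mk_eq_zero] at h
  exact ⟨r, hr, h⟩

variable {R : Type u} [CommRing R]

lemma hasProjectiveDimensionLE_range_of_complex {l : ℕ} {F : ℕ → Type u} [∀ i, AddCommGroup (F i)]
    [∀ i, Module R (F i)] {δ : ∀ i, F i →ₗ[R] F (i + 1)}
    (hF₀ : HasProjectiveDimensionLE (ModuleCat.of R (F 0)) 0)
    (hpd : ∀ i, i + 1 ≤ l → HasProjectiveDimensionLE (ModuleCat.of R (F (i + 1))) i)
    (hinj : Function.Injective (δ 0)) {j : ℕ} (hj : j ≤ l)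
    (hex : ∀ i < j, Function.Exact (δ i) (δ (i + 1))) :
    HasProjectiveDimensionLE (ModuleCat.of R (LinearMap.range (δ j))) j := by
  induction j with
  | zero => exact hasProjectiveDimensionLE_range_of_injective hinj 0
  | succ j ih =>
    have := ih (by omega) fun i hi ↦ hex i (by omega)
    have := hpd j hj
    exact hasProjectiveDimensionLE_range_of_exact (hex j (Nat.lt_succ_self j)) j

/-- A complex of finite torsion-free modules over a Cohen–Macaulay local domain, with
`pd (F (i + 1)) ≤ i`, is exact if it is exact at all primes of height less than `l + 2`. -/
theorem IsLocalRing.exact_of_forall_height_lt [IsDomain R] [IsNoetherianRing R] [IsLocalRing R]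
    {rs : List R} (mem : ∀ r ∈ rs, r ∈ IsLocalRing.maximalIdeal R) (reg : IsRegular R rs)
    (dim : ringKrullDim R = ((rs.length : ℕ∞) : WithBot ℕ∞)) {l : ℕ} {F : ℕ → Type u}
    [∀ i, AddCommGroup (F i)] [∀ i, Module R (F i)] [∀ i, Module.Finite R (F i)]
    {δ : ∀ i, F i →ₗ[R] F (i + 1)} (hδ : ∀ i, δ (i + 1) ∘ₗ δ i = 0)
    (hF₀ : HasProjectiveDimensionLE (ModuleCat.of R (F 0)) 0)
    (hpd : ∀ i, i + 1 ≤ l → HasProjectiveDimensionLE (ModuleCat.of R (F (i + 1))) i)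
    (htf : ∀ i ≤ l + 1, Module.IsTorsionFree R (F i))
    (hker : ∀ q : PrimeSpectrum R, q.asIdeal.height < (l + 2 : ℕ) → ∀ x, δ 0 x = 0 →
      ∃ r ∉ q.asIdeal, r • x = 0)
    (hcoh : ∀ q : PrimeSpectrum R, q.asIdeal.height < (l + 2 : ℕ) → ∀ i x, δ (i + 1) x = 0 →
      ∃ r ∉ q.asIdeal, r • x ∈ LinearMap.range (δ i)) :
    Function.Injective (δ 0) ∧ ∀ i ≤ l, Function.Exact (δ i) (δ (i + 1)) := by
  let η : PrimeSpectrum R := ⟨⊥, Ideal.isPrime_bot⟩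
  have hη : η.asIdeal.height < (l + 2 : ℕ) := by
    rw [show η.asIdeal = ⊥ from rfl, Ideal.height_bot]
    exact_mod_cast Nat.succ_pos _
  have hinj : Function.Injective (δ 0) := by
    rw [injective_iff_map_eq_zero]
    intro x hx
    obtain ⟨r, hr, hrx⟩ := hker η hη x hx
    have := htf 0 (by omega)
    exact (smul_eq_zero.1 hrx).resolve_left hr
  refine ⟨hinj, fun i hi ↦ ?_⟩
  induction i using Nat.strong_induction_on with
  | _ i ih =>
    have hpd_range := hasProjectiveDimensionLE_range_of_complex hF₀ hpd hinj hi
      fun j hj ↦ ih j hj (by omega)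
    have := htf (i + 1) (by omega)
    rw [LinearMap.exact_iff, eq_comm]
    refine Submodule.eq_of_subsingleton_ext (LinearMap.range_le_ker_iff.2 (hδ i))
      (fun x hx ↦ hcoh η hη i x hx) ?_
    let N := ModuleCat.of R (LinearMap.ker (δ (i + 1)) ⧸
      (LinearMap.range (δ i)).submoduleOf (LinearMap.ker (δ (i + 1))))
    have hN : ∀ q ∈ Module.support R N, ((l + 2 : ℕ) : ℕ∞) ≤ q.asIdeal.height := by
      intro q hq
      by_contra! hlt
      refine Module.notMem_support_iff'.2 (fun y ↦ ?_) hq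
      obtain ⟨⟨x, hx⟩, rfl⟩ := Submodule.mkQ_surjective _ y
      obtain ⟨r, hr, hrx⟩ := hcoh q hlt i x hx
      refine ⟨r, hr, ?_⟩
      rw [← map_smul, Submodule.mkQ_apply, Submodule.Quotient.mk_eq_zero]
      exact hrx
    exact ModuleCat.subsingleton_ext_of_hasProjectiveDimensionLE N
      (fun k hk ↦ ModuleCat.subsingleton_ext_of_le_height (ModuleCat.of R R) mem reg dim N hN hk)
      (j := i) (ModuleCat.of R (LinearMap.range (δ i))) (by omega)

lemma LocalizedModule.exists_smul_mem_range_map {S : Submonoid R} {M N L : Type*}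
    [AddCommGroup M] [Module R M] [AddCommGroup N] [Module R N] [AddCommGroup L] [Module R L]
    {f : M →ₗ[R] N} {g : N →ₗ[R] L} {q : Ideal (Localization S)} [q.IsPrime]
    (h : ∀ x, g x = 0 → ∃ r ∉ q.comap (algebraMap R (Localization S)), r • x ∈ LinearMap.range f)
    (y : LocalizedModule S N) (hy : LocalizedModule.map S g y = 0) :
    ∃ r ∉ q, r • y ∈ LinearMap.range (LocalizedModule.map S f) := by
  induction y using LocalizedModule.induction_on with
  | h x s =>
    rw [LocalizedModule.map_mk, ← LocalizedModule.zero_mk 1, LocalizedModule.mk_eq] at hy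
    obtain ⟨u, hu⟩ := hy
    simp only [one_smul, smul_zero, Submonoid.smul_def, ← map_smul] at hu
    obtain ⟨r, hr, z, hz⟩ := h _ hu
    refine ⟨algebraMap R _ (r * u), ?_, LocalizedModule.mk z s, ?_⟩
    · rw [map_mul]
      refine Ideal.IsPrime.mul_notMem inferInstance hr fun hmem ↦ ?_
      exact Ideal.IsPrime.ne_top' (Ideal.eq_top_of_isUnit_mem _ hmem
        (IsLocalization.map_units (Localization S) u))
    · rw [LocalizedModule.map_mk, hz, algebraMap_smul, LocalizedModule.smul'_mk, mul_smul]

/-- The global version of `IsLocalRing.exact_of_forall_height_lt`. -/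
theorem IsCohenMacaulayRing.exact_of_forall_height_lt {R : Type u} [CommRing R] [IsDomain R]
    (hCM : IsCohenMacaulayRing R) {l : ℕ} {F : ℕ → Type u}
    [∀ i, AddCommGroup (F i)] [∀ i, Module R (F i)] [∀ i, Module.Finite R (F i)]
    {δ : ∀ i, F i →ₗ[R] F (i + 1)} (hδ : ∀ i, δ (i + 1) ∘ₗ δ i = 0)
    (hF₀ : HasProjectiveDimensionLE (ModuleCat.of R (F 0)) 0)
    (hpd : ∀ i, i + 1 ≤ l → HasProjectiveDimensionLE (ModuleCat.of R (F (i + 1))) i)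
    (htf : ∀ i ≤ l + 1, Module.IsTorsionFree R (F i))
    (hker : ∀ q : PrimeSpectrum R, q.asIdeal.height < (l + 2 : ℕ) → ∀ x, δ 0 x = 0 →
      ∃ r ∉ q.asIdeal, r • x = 0)
    (hcoh : ∀ q : PrimeSpectrum R, q.asIdeal.height < (l + 2 : ℕ) → ∀ i x, δ (i + 1) x = 0 →
      ∃ r ∉ q.asIdeal, r • x ∈ LinearMap.range (δ i)) :
    Function.Injective (δ 0) ∧ ∀ i ≤ l, Function.Exact (δ i) (δ (i + 1)) := by
  have := hCM.1
  have key (J : Ideal R) [hJ : J.IsMaximal] :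
      Function.Injective (LocalizedModule.map J.primeCompl (δ 0)) ∧ ∀ i ≤ l,
        Function.Exact (LocalizedModule.map J.primeCompl (δ i))
          (LocalizedModule.map J.primeCompl (δ (i + 1))) := by
    obtain ⟨rs, mem, reg, dim⟩ := hCM.2 J hJ
    have : IsDomain (Localization.AtPrime J) :=
      IsLocalization.isDomain_localization J.primeCompl_le_nonZeroDivisors
    have : IsNoetherianRing (Localization.AtPrime J) :=
      IsLocalization.isNoetherianRing J.primeCompl _ inferInstance
    have height_lt {q : PrimeSpectrum (Localization.AtPrime J)}
        (hq : q.asIdeal.height < (l + 2 : ℕ)) :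
        (q.comap (algebraMap R _)).asIdeal.height < (l + 2 : ℕ) := by
      rwa [← IsLocalization.height_under J.primeCompl] at hq
    refine IsLocalRing.exact_of_forall_height_lt (R := Localization.AtPrime J)
      (F := fun i ↦ LocalizedModule J.primeCompl (F i))
      (δ := fun i ↦ LocalizedModule.map J.primeCompl (δ i)) mem reg dim.symm (fun i ↦ ?_)
      (hasProjectiveDimensionLE_localizedModule _ 0 _) (fun i hi ↦ ?_) (fun i hi ↦ ?_)
      (fun q hq x hx ↦ ?_) (fun q hq i x hx ↦ ?_)
    · ext x
      induction x using LocalizedModule.induction_on with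
      | h x s =>
        simp [show δ (i + 1) (δ i x) = 0 from LinearMap.congr_fun (hδ i) x]
    · have := hpd i hi
      exact hasProjectiveDimensionLE_localizedModule _ i _
    · have := htf i hi
      infer_instance
    · have := LocalizedModule.exists_smul_mem_range_map (q := q.asIdeal)
        (f := (0 : F 0 →ₗ[R] F 0)) (fun x hx ↦ by simpa using hker _ (height_lt hq) x hx) x hx
      simpa using this
    · exact LocalizedModule.exists_smul_mem_range_map
        (fun x hx ↦ hcoh _ (height_lt hq) i x hx) x hx
  exact ⟨injective_of_localized_maximal _ fun J _ ↦ (key J).1,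
    fun i hi ↦ exact_of_localized_maximal _ _ fun J _ ↦ (key J).2 i hi⟩

end Complex

/- `A = k[X]` is the Cohen–Macaulay coordinate ring of an irreducible affine variety over
the algebraically closed field `k`, `Z ⊆ Spec A` is closed.  The cochain complex
`0 → E₋₁ → E₀ → ⋯ → E_l → 0` is modelled by `F : ℕ → Type` with `F 0 = E₋₁` and
`F (i+1) = E_i` (trivial beyond `l + 1`), with differentials `δ i : F i → F (i+1)`.
Assume (1) `E₋₁` is projective and `E_i` has projective dimension `≤ i` for
`0 ≤ i ≤ l-1`; (2) `Z` contains the support of the cohomology of the complex;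
(3) `E_i` embeds into a free module for `0 ≤ i ≤ l`; (4) `A` is normal and
`codim Z ≥ l + 2`.  Then the complex is exact and `E_l` has projective dimension `≤ l`. -/
theorem stmt16
    (k : Type) [Field k] [IsAlgClosed k]
    (A : Type) [CommRing A] [IsDomain A] [Algebra k A]
    (hfg : Algebra.FiniteType k A)
    (hCM : IsCohenMacaulayRing A)
    (Z : Set (PrimeSpectrum A)) (hZ : IsClosed Z)
    (l : ℕ)
    (F : ℕ → Type) [∀ i, AddCommGroup (F i)] [∀ i, Module A (F i)]
    (hfin : ∀ i, Module.Finite A (F i))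
    (htriv : ∀ i, l + 1 < i → Subsingleton (F i))
    (δ : ∀ i, F i →ₗ[A] F (i + 1))
    (hδδ : ∀ i, (δ (i + 1)).comp (δ i) = 0)
    (hproj : Module.Projective A (F 0))
    (hpd : ∀ i, i + 1 ≤ l → ProjDimLE A i (F (i + 1)))
    (hsupp0 : Module.support A ↥(LinearMap.ker (δ 0)) ⊆ Z)
    (hsupp : ∀ i, Module.support A
        (↥(LinearMap.ker (δ (i + 1))) ⧸
          (LinearMap.range (δ i)).comap (LinearMap.ker (δ (i + 1))).subtype) ⊆ Z)
    (hfree : ∀ i, i ≤ l → ∃ (ι : Type) (f : F (i + 1) →ₗ[A] (ι →₀ A)), Function.Injective f)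
    (hnormal : IsIntegrallyClosed A)
    (hcodim : (l + 2 : ℕ∞) ≤ ⨅ q ∈ Z, Order.height q) :
    Function.Injective (δ 0) ∧
    (∀ i, LinearMap.range (δ i) = LinearMap.ker (δ (i + 1))) ∧
    ProjDimLE A l (F (l + 1)) := by
  have hN := hCM.1
  have hF₀ : HasProjectiveDimensionLE (ModuleCat.of A (F 0)) 0 :=
    (projDimLE_iff_hasProjectiveDimensionLE 0 (F 0)).1 hproj
  have hpd' (i : ℕ) (hi : i + 1 ≤ l) : HasProjectiveDimensionLE (ModuleCat.of A (F (i + 1))) i :=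
    (projDimLE_iff_hasProjectiveDimensionLE i (F (i + 1))).1 (hpd i hi)
  have htf (i : ℕ) (hi : i ≤ l + 1) : Module.IsTorsionFree A (F i) := by
    cases i with
    | zero => infer_instance
    | succ i =>
      obtain ⟨ι, f, hf⟩ := hfree i (by omega)
      exact hf.moduleIsTorsionFree f (map_smul f)
  have notMem {q : PrimeSpectrum A} (hq : q.asIdeal.height < (l + 2 : ℕ)) : q ∉ Z := by
    intro hqZ
    rw [PrimeSpectrum.height_eq_orderHeight] at hq
    exact hq.not_ge ((by exact_mod_cast hcodim : ((l + 2 : ℕ) : ℕ∞) ≤ _).trans (iInf₂_le q hqZ))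
  obtain ⟨hinj, hex⟩ := hCM.exact_of_forall_height_lt hδδ hF₀ hpd' htf
    (fun q hq x hx ↦ by
      obtain ⟨r, hr, h⟩ := Module.notMem_support_iff'.1 (fun h ↦ notMem hq (hsupp0 h))
        (⟨x, hx⟩ : LinearMap.ker (δ 0))
      exact ⟨r, hr, congrArg Subtype.val h⟩)
    (fun q hq i x hx ↦ PrimeSpectrum.exists_smul_mem_of_support_subset
      (fun h ↦ notMem hq (hsupp i h)) hx)
  have hrange (i : ℕ) : LinearMap.range (δ i) = LinearMap.ker (δ (i + 1)) := by
    by_cases hi : i ≤ l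
    · exact (LinearMap.exact_iff.1 (hex i hi)).symm
    · have := htriv (i + 1) (by omega)
      exact Subsingleton.elim _ _
  refine ⟨hinj, hrange, ?_⟩
  have := hasProjectiveDimensionLE_range_of_complex hF₀ hpd' hinj le_rfl
    fun i hi ↦ hex i (by omega)
  have htop : LinearMap.range (δ l) = ⊤ := by
    have := htriv (l + 2) (by omega)
    rw [hrange, LinearMap.ker_eq_top]
    exact Subsingleton.elim _ _
  rw [projDimLE_iff_hasProjectiveDimensionLE]
  exact hasProjectiveDimensionLT_of_iso (LinearEquiv.ofTop _ htop).toModuleIso _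
end

section
/- For all integers e, k, l with 2 ≤ e ≤ k ≤ l, the rational number ψ(e,k,l) is nonzero. -/
/-- `r(k,l) = ∑_{j=0}^{k-1} (-1)^j C(l,j)`. -/
noncomputable def rSum (k l : ℕ) : ℚ :=
  ∑ j ∈ Finset.range k, (-1 : ℚ) ^ j * (l.choose j : ℚ)

/-- `c(k,l) = ∑_{j=0}^{k} (-1)^j / (j! (l+j)!)`. -/
noncomputable def cSum (k l : ℕ) : ℚ :=
  ∑ j ∈ Finset.range (k + 1), (-1 : ℚ) ^ j / ((j.factorial : ℚ) * ((l + j).factorial : ℚ))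

/-- `ψ(e,k,l) = r(k,l) - ∑_{j=1}^{e-1} (-1)^{k-j} c(j,k-j) r(j,l) (l-j)!/(l-k)!`. -/
noncomputable def psiSum (e k l : ℕ) : ℚ :=
  rSum k l - ∑ j ∈ Finset.Ico 1 e,
    (-1 : ℚ) ^ (k - j) * cSum j (k - j) * rSum j l *
      (((l - j).factorial : ℚ) / ((l - k).factorial : ℚ))

theorem rSum_succ_succ (k l : ℕ) : rSum (k + 1) (l + 1) = (-1 : ℚ) ^ k * (l.choose k : ℚ) := by
  have h := congrArg (Int.cast : ℤ → ℚ)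
    (Int.alternating_sum_range_choose_eq_choose (n := l) (m := k))
  push_cast at h
  exact h

theorem rSum_eq_factorial_div {k l : ℕ} (hk : 1 ≤ k) (hkl : k ≤ l) :
    rSum k l = (-1 : ℚ) ^ (k - 1) *
      (((l - 1).factorial : ℚ) / (((k - 1).factorial : ℚ) * ((l - k).factorial : ℚ))) := by
  obtain ⟨k, rfl⟩ := Nat.exists_eq_add_of_le' hk
  obtain ⟨l, rfl⟩ := Nat.exists_eq_add_of_le' (hk.trans hkl)
  rw [rSum_succ_succ, Nat.cast_choose ℚ (by lia : k ≤ l)]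
  simp

/-- Every partial sum of an alternating series with nonnegative decreasing terms lies between `0`
and the first term. -/
theorem alternating_sum_range_mem_Icc (a : ℕ → ℚ) (ha : Antitone a) (h0 : ∀ i, 0 ≤ a i) (n : ℕ) :
    ∑ i ∈ Finset.range n, (-1 : ℚ) ^ i * a i ∈ Set.Icc 0 (a 0) := by
  induction n generalizing a with
  | zero => simpa using h0 0
  | succ n ih =>
    obtain ⟨h1, h2⟩ := ih (fun i => a (i + 1)) (fun i j h => ha (by lia)) fun i => h0 _
    have h3 : a 1 ≤ a 0 := ha zero_le_one
    have h4 : ∑ i ∈ Finset.range n, (-1 : ℚ) ^ (i + 1) * a (i + 1) =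
        -∑ i ∈ Finset.range n, (-1 : ℚ) ^ i * a (i + 1) := by
      rw [← Finset.sum_neg_distrib]
      exact Finset.sum_congr rfl fun i _ => by ring
    rw [Finset.sum_range_succ', h4]
    simp only [zero_add] at h2
    constructor <;> simp <;> linarith

theorem cSum_nonneg (k l : ℕ) : 0 ≤ cSum k l := by
  have h := (alternating_sum_range_mem_Icc
    (fun j => 1 / ((j.factorial : ℚ) * ((l + j).factorial : ℚ)))
    (fun i j hij => by dsimp only; gcongr) (fun i => by positivity) (k + 1)).1
  simpa only [mul_one_div, cSum] using h

/-- The factor of `psiSum e k l` that does not depend on `l`. -/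
noncomputable def psiFactor (e k : ℕ) : ℚ :=
  1 / ((k - 1).factorial : ℚ) -
    ∑ j ∈ Finset.Ico 1 e, cSum j (k - j) / ((j - 1).factorial : ℚ)

theorem psiSum_eq_mul_psiFactor {e k l : ℕ} (hk : 1 ≤ k) (hek : e ≤ k) (hkl : k ≤ l) :
    psiSum e k l = (-1 : ℚ) ^ (k - 1) *
      (((l - 1).factorial : ℚ) / ((l - k).factorial : ℚ)) * psiFactor e k := by
  rw [psiSum, psiFactor, mul_sub, Finset.mul_sum, rSum_eq_factorial_div hk hkl]
  congr 1
  · field_simp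
  · refine Finset.sum_congr rfl fun j hj => ?_
    obtain ⟨hj1, hje⟩ := Finset.mem_Ico.mp hj
    rw [rSum_eq_factorial_div hj1 (by lia), show k - 1 = (k - j) + (j - 1) by lia, pow_add]
    have := Nat.factorial_ne_zero (l - j)
    field_simp

theorem psiFactor_two {k : ℕ} (hk : 1 ≤ k) : psiFactor 2 k = 1 / (k.factorial : ℚ) := by
  simp [psiFactor, cSum, Finset.sum_range_succ, Nat.sub_add_cancel hk, neg_div]

theorem psiFactor_neg {e k : ℕ} (he : 3 ≤ e) (hek : e ≤ k) : psiFactor e k < 0 := by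
  have hanti : psiFactor e k ≤ psiFactor 3 k := by
    refine sub_le_sub_left (Finset.sum_le_sum_of_subset_of_nonneg
      (Finset.Ico_subset_Ico_right he) fun j _ _ => ?_) _
    exact div_nonneg (cSum_nonneg _ _) (by positivity)
  have hstep : psiFactor 3 k = psiFactor 2 k - cSum 2 (k - 2) := by
    simp [psiFactor, Finset.sum_Ico_succ_top, sub_sub]
  rw [psiFactor_two (by lia)] at hstep
  obtain ⟨m, rfl⟩ := Nat.exists_eq_add_of_le' (he.trans hek)
  have hpos : 1 / ((m + 3).factorial : ℚ) < cSum 2 (m + 1) := by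
    have h := Nat.factorial_pos (m + 1)
    simp only [cSum, Finset.sum_range_succ, Finset.sum_range_zero, add_assoc, Nat.reduceAdd,
      Nat.factorial_succ (m + 2), Nat.factorial_succ (m + 1)]
    push_cast
    norm_num
    field_simp
    ring_nf
    have : (0 : ℚ) ≤ m := m.cast_nonneg
    nlinarith [sq_nonneg (m : ℚ)]
  rw [show m + 3 - 2 = m + 1 by lia] at hstep
  linarith

theorem stmt19 (e k l : ℕ) (he : 2 ≤ e) (hek : e ≤ k) (hkl : k ≤ l) :
    psiSum e k l ≠ 0 := by
  rw [psiSum_eq_mul_psiFactor (by lia) hek hkl]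
  refine mul_ne_zero (mul_ne_zero (by simp) (by positivity)) ?_
  obtain rfl | he := he.eq_or_lt
  · rw [psiFactor_two (by lia)]
    positivity
  · exact (psiFactor_neg he hek).ne
end
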